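/- Let Δ be a simplicial complex on [n] with facets F_1,…,F_t, and let M_Δ be the C(t,2) × t matrix over S = K[x_1,…,x_n] whose row indexed by a pair (i,j) with 1 ≤ i < j ≤ t has entry x_{F_i∖F_j} in column i, entry x_{F_j∖F_i} in column j, and 0 in every other column. Then Δ is a quasi-tree if and only if there is a choice of t−1 rows of M_Δ forming a (t−1) × t submatrix M^♯ such that for every j ∈ [t], the (t−1) × (t−1) submatrix M^♯(j) obtained by deleting column j of M^♯ satisfies det(M^♯(j)) = ± x_{[n]}/x_{F_j}, i.e., the determinant equals, up to sign, the monomial ∏_{k ∈ [n]∖F_j} x_k. -/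

import Mathlib

open Finset

/-- A simplicial complex on the vertex set `Fin n`: contains all singletons and is
closed under taking subsets. -/
def IsComplex {n : ℕ} (Δ : Set (Finset (Fin n))) : Prop :=
  (∀ i : Fin n, {i} ∈ Δ) ∧ ∀ F ∈ Δ, ∀ G ⊆ F, G ∈ Δ

/-- Closed under taking subsets (a simplicial complex, singletons not required). -/
def IsLowerComplex {n : ℕ} (Δ : Set (Finset (Fin n))) : Prop :=
  ∀ F ∈ Δ, ∀ G ⊆ F, G ∈ Δ

/-- The set of facets (maximal faces) of `Δ`. -/
def facets {n : ℕ} (Δ : Set (Finset (Fin n))) : Set (Finset (Fin n)) :=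
  {F | F ∈ Δ ∧ ∀ G ∈ Δ, F ⊆ G → F = G}

/-- The simplicial complex generated by a family of subsets of `Fin n`. -/
def gen {n : ℕ} (S : Set (Finset (Fin n))) : Set (Finset (Fin n)) :=
  {G | ∃ F ∈ S, G ⊆ F}

/-- `F` is a leaf of `Δ`: either `F` is the only facet, or there is a facet `G ≠ F`
(a branch of `F`) with `H ∩ F ⊆ G ∩ F` for every facet `H ≠ F`. -/
def IsLeaf {n : ℕ} (Δ : Set (Finset (Fin n))) (F : Finset (Fin n)) : Prop :=
  F ∈ facets Δ ∧
    (facets Δ = {F} ∨ ∃ G ∈ facets Δ, G ≠ F ∧ ∀ H ∈ facets Δ, H ≠ F → H ∩ F ⊆ G ∩ F)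

/-- `Δ` is a quasi-tree: there is a labeling `F₁, …, F_m` of its facets such that `F_i`
is a leaf of `⟨F₁, …, F_i⟩` for every `i` (a leaf order). -/
def IsQuasiTree {n : ℕ} (Δ : Set (Finset (Fin n))) : Prop :=
  ∃ L : List (Finset (Fin n)), L.Nodup ∧ {F | F ∈ L} = facets Δ ∧
    ∀ i : Fin L.length, IsLeaf (gen {F | F ∈ L.take (i.1 + 1)}) (L.get i)

/-- `Δ` is pure: all facets have the same cardinality. -/
def IsPure {n : ℕ} (Δ : Set (Finset (Fin n))) : Prop :=
  ∀ F ∈ facets Δ, ∀ G ∈ facets Δ, F.card = G.card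

/-- `Δ` is shellable: it is pure and there is an order `F₁, …, F_m` of its facets such
that for all `j < i` and `x ∈ F_i \ F_j` there is `k < i` with `F_i \ F_k = {x}`. -/
def IsShellable {n : ℕ} (Δ : Set (Finset (Fin n))) : Prop :=
  IsPure Δ ∧ ∃ L : List (Finset (Fin n)), L.Nodup ∧ {F | F ∈ L} = facets Δ ∧
    ∀ i j : Fin L.length, j < i →
      ∀ x ∈ L.get i \ L.get j, ∃ k : Fin L.length, k < i ∧ L.get i \ L.get k = {x}

/-- The `i`-skeleton of `Δ`: the complex generated by the faces of dimension `i`. -/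
def skel {n : ℕ} (Δ : Set (Finset (Fin n))) (i : ℕ) : Set (Finset (Fin n)) :=
  gen {F | F ∈ Δ ∧ F.card = i + 1}

/-- The Alexander dual of `Δ`: `Δ^∨ = {[n] \ F : F ∉ Δ}`. -/
def dual {n : ℕ} (Δ : Set (Finset (Fin n))) : Set (Finset (Fin n)) :=
  {G | Gᶜ ∉ Δ}

/-- `Δ^c`, the complex generated by the complements of the facets of `Δ`. -/
def complements {n : ℕ} (Δ : Set (Finset (Fin n))) : Set (Finset (Fin n)) :=
  gen ((·ᶜ) '' facets Δ)

/-- `Δ` is flag: every minimal nonface has exactly two elements. -/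
def IsFlag {n : ℕ} (Δ : Set (Finset (Fin n))) : Prop :=
  ∀ F : Finset (Fin n), F ∉ Δ → (∀ G ⊂ F, G ∈ Δ) → F.card = 2

/-- The squarefree monomial `x_F = ∏_{i ∈ F} x_i`. -/
noncomputable def xF {n : ℕ} (K : Type) [Field K] (F : Finset (Fin n)) :
    MvPolynomial (Fin n) K := ∏ i ∈ F, MvPolynomial.X i

/-- The Stanley–Reisner ideal of `Δ`, generated by the monomials `x_F` with `F` a
nonface of `Δ`. -/
noncomputable def SRIdeal {n : ℕ} (K : Type) [Field K] (Δ : Set (Finset (Fin n))) :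
    Ideal (MvPolynomial (Fin n) K) := Ideal.span (xF K '' {F | F ∉ Δ})

/-- The facet ideal of `Δ`, generated by the monomials `x_F` with `F` a facet of `Δ`. -/
noncomputable def facetIdeal {n : ℕ} (K : Type) [Field K] (Δ : Set (Finset (Fin n))) :
    Ideal (MvPolynomial (Fin n) K) := Ideal.span (xF K '' facets Δ)

/-- A set `G` of monomials (assumed to be the minimal monomial generating set of the
ideal it generates) has linear quotients: there is an order `f₁, …, f_m` of `G` such
that each colon ideal `(f₁,…,f_{i-1}) : f_i` is generated by a set of variables. -/
def HasLinearQuotients {n : ℕ} (K : Type) [Field K]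
    (G : Set (MvPolynomial (Fin n) K)) : Prop :=
  ∃ L : List (MvPolynomial (Fin n) K), L.Nodup ∧ {f | f ∈ L} = G ∧
    ∀ i : Fin L.length, 0 < i.1 →
      ∃ V : Set (Fin n),
        Submodule.colon (Ideal.span {f | f ∈ L.take i.1}) (Ideal.span {L.get i}) =
          Ideal.span (MvPolynomial.X '' V)

/-- The clique complex `Δ(G)` of a graph `G`: faces are the cliques of `G`. -/
def cliqueComplex {n : ℕ} (G : SimpleGraph (Fin n)) : Set (Finset (Fin n)) :=
  {F | ∀ i ∈ F, ∀ j ∈ F, i ≠ j → G.Adj i j}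

/-- A graph is chordal if every cycle of length at least 4 has a chord, i.e. an edge of
the graph joining two vertices of the cycle which is not an edge of the cycle. -/
def IsChordalGraph {V : Type} (G : SimpleGraph V) : Prop :=
  ∀ (v : V) (c : G.Walk v v), c.IsCycle → 4 ≤ c.length →
    ∃ x y, G.Adj x y ∧ x ∈ c.support ∧ y ∈ c.support ∧ s(x, y) ∉ c.edges

/-- A module `M` over `S` has projective dimension at most one: some (equivalently, by
Schanuel's lemma, any) presentation of `M` by a free module has projective kernel. -/
def ProjDimLEOne (S : Type) [CommRing S] (M : Type) [AddCommGroup M] [Module S M] : Prop :=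
  ∃ (ι : Type) (f : (ι →₀ S) →ₗ[S] M), Function.Surjective f ∧
    Module.Projective S (LinearMap.ker f)

/-- The monomial with exponent vector `a`. -/
noncomputable def mono {n : ℕ} (K : Type) [Field K] (a : Fin n → ℕ) :
    MvPolynomial (Fin n) K := MvPolynomial.monomial (Finsupp.equivFunOnFinite.symm a) 1

/-- The Taylor relation `r_{ij} = u_{ji} e_i - u_{ij} e_j` for the monomials with
exponent vectors `a i`, `a j`, where `u_{ij} = u_i / gcd(u_i, u_j)`. -/
noncomputable def taylorRel {n t : ℕ} (K : Type) [Field K] (a : Fin t → Fin n → ℕ)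
    (i j : Fin t) : Fin t → MvPolynomial (Fin n) K :=
  Pi.single i (mono K (a j - a i ⊓ a j)) - Pi.single j (mono K (a i - a i ⊓ a j))

/-- The entry in column `c` of the row of the matrix `M_Δ` indexed by the pair
`p = (i, j)`: it is `x_{F_i ∖ F_j}` in column `i`, `x_{F_j ∖ F_i}` in column `j`, and
`0` elsewhere. -/
noncomputable def rowEntry {n t : ℕ} (K : Type) [Field K]
    (F : Fin (t + 1) → Finset (Fin n)) (p : Fin (t + 1) × Fin (t + 1))
    (c : Fin (t + 1)) : MvPolynomial (Fin n) K :=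
  if c = p.1 then xF K (F p.1 \ F p.2)
  else if c = p.2 then xF K (F p.2 \ F p.1) else 0

/-- Each entry of the list is a leaf of the complex generated by it and the later entries
(a leaf order read backwards). -/
def RunningIntersection {α : Type*} [DecidableEq α] : List (Finset α) → Prop
  | [] => True
  | A :: L => (L = [] ∨ ∃ G ∈ L, ∀ H ∈ L, H ∩ A ⊆ G) ∧ RunningIntersection L

lemma facets_gen {n : ℕ} {S : Set (Finset (Fin n))} (hS : IsAntichain (· ⊆ ·) S) :
    facets (gen S) = S := by
  ext A
  constructor
  · rintro ⟨⟨B, hB, hAB⟩, h⟩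
    rwa [h B ⟨B, hB, subset_rfl⟩ hAB]
  · refine fun hA => ⟨⟨A, hA, subset_rfl⟩, ?_⟩
    rintro G ⟨B, hB, hGB⟩ hAG
    have hAB : A = B := hS.eq hA hB (hAG.trans hGB)
    exact hAG.antisymm (hAB ▸ hGB)

lemma isLeaf_gen_append_singleton_iff {n : ℕ} {L : List (Finset (Fin n))} {A : Finset (Fin n)}
    (hnd : (L ++ [A]).Nodup) (hS : IsAntichain (· ⊆ ·) {F | F ∈ L ++ [A]}) :
    IsLeaf (gen {F | F ∈ L ++ [A]}) A ↔ L = [] ∨ ∃ G ∈ L, ∀ H ∈ L, H ∩ A ⊆ G := by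
  have hA : A ∉ L := by
    intro h
    exact (List.nodup_append.1 hnd).2.2 A h A (by simp) rfl
  have hne : ∀ H ∈ L, H ≠ A := fun H hH h => hA (h ▸ hH)
  rw [IsLeaf, facets_gen hS]
  constructor
  · rintro ⟨-, h | ⟨G, hG, hGA, h⟩⟩
    · left
      refine List.eq_nil_iff_forall_not_mem.2 fun H hH => hne H hH ?_
      have : H ∈ ({A} : Set (Finset (Fin n))) := h ▸ by simp [hH]
      simpa using this
    · right
      refine ⟨G, by simpa [hGA] using hG, fun H hH => ?_⟩
      exact (h H (by simp [hH]) (hne H hH)).trans inter_subset_left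
  · rintro (rfl | ⟨G, hG, h⟩)
    · simp
    · refine ⟨by simp, Or.inr ⟨G, by simp [hG], hne G hG, fun H hH hHA => ?_⟩⟩
      exact subset_inter (h H (by simpa [hHA] using hH)) inter_subset_right

lemma forall_isLeaf_take_iff {n : ℕ} (L : List (Finset (Fin n)))
    (hnd : L.Nodup) (hS : IsAntichain (· ⊆ ·) {F | F ∈ L}) :
    (∀ (i : ℕ) (h : i < L.length), IsLeaf (gen {F | F ∈ L.take (i + 1)}) L[i]) ↔
      RunningIntersection L.reverse := by
  induction L using List.reverseRecOn with
  | nil => simp [RunningIntersection]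
  | append_singleton L A ih =>
    have hL := ih (List.nodup_append.1 hnd).1
      (hS.subset fun F hF => List.mem_append_left _ hF)
    have hleaf := isLeaf_gen_append_singleton_iff hnd hS
    have hrev : RunningIntersection (L ++ [A]).reverse ↔
        (L = [] ∨ ∃ G ∈ L, ∀ H ∈ L, H ∩ A ⊆ G) ∧ RunningIntersection L.reverse := by
      simp [RunningIntersection]
    rw [hrev, ← hleaf, ← hL]
    constructor
    · refine fun h => ⟨?_, fun i hi => ?_⟩
      · have := h L.length (by simp)
        rwa [List.take_of_length_le (by simp), List.getElem_concat_length rfl] at this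
      · have := h i (by simp; omega)
        rwa [List.take_append_of_le_length (by omega), List.getElem_append_left hi] at this
    · rintro ⟨h₁, h₂⟩ i hi
      have hi' : i < L.length ∨ i = L.length := by simp at hi; omega
      rcases hi' with hi' | rfl
      · rw [List.take_append_of_le_length (by omega), List.getElem_append_left hi']
        exact h₂ i hi'
      · rwa [List.take_of_length_le (by simp), List.getElem_concat_length rfl]

lemma isAntichain_facets {n : ℕ} (Δ : Set (Finset (Fin n))) :
    IsAntichain (· ⊆ ·) (facets Δ) :=
  fun _ hA _ hB hne h => hne (hA.2 _ hB.1 h)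

lemma isQuasiTree_iff_exists_runningIntersection {n : ℕ} (Δ : Set (Finset (Fin n))) :
    IsQuasiTree Δ ↔ ∃ L : List (Finset (Fin n)), L.Nodup ∧ {F | F ∈ L} = facets Δ ∧
      RunningIntersection L := by
  constructor
  · rintro ⟨L, hnd, hL, h⟩
    refine ⟨L.reverse, List.nodup_reverse.2 hnd, by simpa using hL, ?_⟩
    exact (forall_isLeaf_take_iff L hnd (hL ▸ isAntichain_facets Δ)).1 fun i hi => h ⟨i, hi⟩
  · rintro ⟨L, hnd, hL, h⟩
    have hL' : {F | F ∈ L.reverse} = facets Δ := by simpa using hL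
    refine ⟨L.reverse, List.nodup_reverse.2 hnd, hL', fun i => ?_⟩
    exact (forall_isLeaf_take_iff L.reverse (List.nodup_reverse.2 hnd)
      (hL' ▸ isAntichain_facets Δ)).2 (by simpa using h) i i.2

section Monomials

variable {n : ℕ} (K : Type) [Field K]

lemma xF_ne_zero (A : Finset (Fin n)) : xF K A ≠ 0 :=
  prod_ne_zero_iff.2 fun _ _ => MvPolynomial.X_ne_zero _

lemma xF_mul_of_disjoint {A B : Finset (Fin n)} (h : Disjoint A B) :
    xF K A * xF K B = xF K (A ∪ B) :=
  (prod_union h).symm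

lemma subset_of_xF_dvd_xF {A B : Finset (Fin n)} (h : xF K A ∣ xF K B) : A ⊆ B := by
  intro v hv
  have hX : (MvPolynomial.X v : MvPolynomial (Fin n) K) ∣ xF K B :=
    (dvd_prod_of_mem _ hv).trans h
  obtain ⟨w, hw, hvw⟩ := (MvPolynomial.X_prime (R := K) (i := v)).exists_mem_finset_dvd hX
  rwa [MvPolynomial.X_dvd_X.1 hvw]

end Monomials

section Minors

variable {n : ℕ} (K : Type) [Field K]

lemma rowEntry_map {s t : ℕ} (F : Fin (t + 1) → Finset (Fin n)) {f : Fin (s + 1) → Fin (t + 1)}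
    (hf : Function.Injective f) (p : Fin (s + 1) × Fin (s + 1)) (c : Fin (s + 1)) :
    rowEntry K F (p.map f f) (f c) = rowEntry K (F ∘ f) p c := by
  simp [rowEntry, hf.eq_iff]

lemma rowEntry_eq_zero {t : ℕ} (F : Fin (t + 1) → Finset (Fin n))
    {p : Fin (t + 1) × Fin (t + 1)} {c : Fin (t + 1)} (h₁ : c ≠ p.1) (h₂ : c ≠ p.2) :
    rowEntry K F p c = 0 := by
  simp [rowEntry, h₁, h₂]

/-- The minor of `M_Δ` with the given rows obtained by deleting column `j`. -/
noncomputable def minor {t : ℕ} (F : Fin (t + 1) → Finset (Fin n))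
    (rows : Fin t → Fin (t + 1) × Fin (t + 1)) (j : Fin (t + 1)) : MvPolynomial (Fin n) K :=
  Matrix.det (Matrix.of fun k l : Fin t => rowEntry K F (rows k) (j.succAbove l))

variable {t : ℕ} (F : Fin (t + 2) → Finset (Fin n))
  (rows : Fin (t + 1) → Fin (t + 2) × Fin (t + 2)) (rows' : Fin t → Fin (t + 1) × Fin (t + 1))
  (i : Fin (t + 2)) (k : Fin (t + 1))

/-- Expansion of a minor along a column with a single nonzero entry. -/
lemma minor_succAbove
    (h : ∀ a, rows (k.succAbove a) = (rows' a).map i.succAbove i.succAbove) (j : Fin (t + 1)) :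
    ∃ e : ℕ, minor K F rows (i.succAbove j) =
      (-1) ^ e * (rowEntry K F (rows k) i * minor K (F ∘ i.succAbove) rows' j) := by
  refine ⟨k + j.predAbove i, ?_⟩
  rw [minor, Matrix.det_succ_column _ (j.predAbove i), Finset.sum_eq_single k]
  · rw [mul_assoc, minor]
    congr 2
    · simp [Fin.succAbove_succAbove_predAbove]
    · congr 1
      ext1 a b
      simp only [Matrix.submatrix_apply, Matrix.of_apply, h,
        Fin.succAbove_succAbove_succAbove_predAbove]
      exact rowEntry_map K F Fin.succAbove_right_injective _ _
  · intro b _ hb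
    obtain ⟨a, rfl⟩ := Fin.exists_succAbove_eq hb
    rw [Matrix.of_apply, h, Fin.succAbove_succAbove_predAbove, rowEntry_eq_zero]
    · simp
    · exact (Fin.succAbove_ne _ _).symm
    · exact (Fin.succAbove_ne _ _).symm
  · simp

/-- Expansion of a minor along a row with a single nonzero entry. -/
lemma minor_self
    (h : ∀ a, rows (k.succAbove a) = (rows' a).map i.succAbove i.succAbove) (p : Fin (t + 1))
    (hp : ∀ c, c ≠ p → rowEntry K F (rows k) (i.succAbove c) = 0) :
    ∃ e : ℕ, minor K F rows i = (-1) ^ e *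
      (rowEntry K F (rows k) (i.succAbove p) * minor K (F ∘ i.succAbove) rows' p) := by
  refine ⟨k + p, ?_⟩
  rw [minor, Matrix.det_succ_row _ k, Finset.sum_eq_single p]
  · rw [mul_assoc, minor]
    congr 3
    ext1 a b
    simp only [Matrix.submatrix_apply, Matrix.of_apply, h]
    exact rowEntry_map K F Fin.succAbove_right_injective _ _
  · intro c _ hc
    simp [hp c hc]
  · simp

end Minors

lemma eq_or_eq_neg_neg_one_pow_mul {R : Type*} [CommRing R] {a b : R} (e : ℕ)
    (h : a = b ∨ a = -b) : (-1) ^ e * a = b ∨ (-1) ^ e * a = -b := by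
  rcases neg_one_pow_eq_or R e with he | he <;> rcases h with rfl | rfl <;> simp [he]

lemma mul_eq_or_eq_neg {R : Type*} [CommRing R] {a b : R} (c : R)
    (h : a = b ∨ a = -b) : c * a = c * b ∨ c * a = -(c * b) := by
  rcases h with rfl | rfl <;> simp

lemma range_comp_succAbove {α : Type*} {t : ℕ} {F : Fin (t + 1) → α} (hF : Function.Injective F)
    (i : Fin (t + 1)) : Set.range (F ∘ i.succAbove) = Set.range F \ {F i} := by
  rw [Set.range_comp, Fin.range_succAbove, Set.image_compl_eq_range_sdiff_image hF,
    Set.image_singleton]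

/-- If no column of the chosen rows vanishes, then some column meets exactly one row. -/
lemma exists_column_meeting_one_row {t : ℕ} (rows : Fin t → Fin (t + 1) × Fin (t + 1))
    (h : ∀ c, ∃ k, c = (rows k).1 ∨ c = (rows k).2) :
    ∃ c k, (c = (rows k).1 ∨ c = (rows k).2) ∧
      ∀ k', k' ≠ k → c ≠ (rows k').1 ∧ c ≠ (rows k').2 := by
  let f : Fin t × Bool → Fin (t + 1) := fun q => if q.2 then (rows q.1).2 else (rows q.1).1
  obtain ⟨c, hc⟩ := Fintype.exists_card_fiber_lt_of_card_lt_mul (f := f) (n := 2)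
    (by simp)
  have hc' := Finset.card_le_one.1 (Nat.lt_succ_iff.1 hc)
  obtain ⟨k, hk⟩ := h c
  have key : ∀ k', (c = (rows k').1 ∨ c = (rows k').2) → ∃ b, f (k', b) = c := by
    rintro k' (h' | h')
    · exact ⟨false, by simp [f, h'.symm]⟩
    · exact ⟨true, by simp [f, h'.symm]⟩
  obtain ⟨b, hb⟩ := key k hk
  refine ⟨c, k, hk, fun k' hk' => not_or.1 fun h' => hk' ?_⟩
  obtain ⟨b', hb'⟩ := key k' h'
  exact congrArg Prod.fst (hc' (k', b') (by simp [hb']) (k, b) (by simp [hb]))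

/-- Signed monomial minors force a leaf order of the family. -/
theorem exists_runningIntersection_of_minor {n t : ℕ} (K : Type) [Field K]
    (F : Fin (t + 1) → Finset (Fin n)) (hinj : Function.Injective F) (V : Finset (Fin n))
    (hV : ∀ j, F j ⊆ V) (rows : Fin t → Fin (t + 1) × Fin (t + 1))
    (hrows : ∀ k, (rows k).1 ≠ (rows k).2)
    (hdet : ∀ j, minor K F rows j = xF K (V \ F j) ∨ minor K F rows j = -xF K (V \ F j)) :
    ∃ L : List (Finset (Fin n)), L.Nodup ∧ {A | A ∈ L} = Set.range F ∧
      RunningIntersection L := by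
  induction t generalizing V with
  | zero => exact ⟨[F 0], by simp, by ext A; simp [eq_comm], by simp [RunningIntersection]⟩
  | succ t ih =>
    have hcol : ∀ c, ∃ k, c = (rows k).1 ∨ c = (rows k).2 := by
      intro c
      by_contra! hc
      obtain ⟨j, hj⟩ := exists_ne c
      obtain ⟨l, hl⟩ := Fin.exists_succAbove_eq hj.symm
      have h0 : minor K F rows j = 0 :=
        Matrix.det_eq_zero_of_column_eq_zero l fun k => by
          rw [Matrix.of_apply, hl]
          exact rowEntry_eq_zero K F (hc k).1 (hc k).2
      have := hdet j
      simp only [h0, eq_comm (a := (0 : MvPolynomial (Fin n) K)), neg_eq_zero,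
        xF_ne_zero, or_self] at this
    obtain ⟨i, k, hik, hk⟩ := exists_column_meeting_one_row rows hcol
    obtain ⟨p, hp⟩ : ∃ p, rowEntry K F (rows k) i = xF K (F i \ F (i.succAbove p)) := by
      rcases hik with h | h
      · obtain ⟨p, hp⟩ := Fin.exists_succAbove_eq (x := (rows k).2) (y := i)
          (h ▸ (hrows k).symm)
        exact ⟨p, by rw [hp]; simp [rowEntry, h]⟩
      · obtain ⟨p, hp⟩ := Fin.exists_succAbove_eq (x := (rows k).1) (y := i)
          (h ▸ hrows k)
        exact ⟨p, by rw [hp]; simp [rowEntry, h, (hrows k).symm]⟩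
    have hex : ∀ a, ∃ q : Fin (t + 1) × Fin (t + 1),
        rows (k.succAbove a) = q.map i.succAbove i.succAbove := by
      intro a
      obtain ⟨h₁, h₂⟩ := hk _ (Fin.succAbove_ne k a)
      obtain ⟨q₁, hq₁⟩ := Fin.exists_succAbove_eq h₁.symm
      obtain ⟨q₂, hq₂⟩ := Fin.exists_succAbove_eq h₂.symm
      exact ⟨(q₁, q₂), by ext1 <;> simp [hq₁, hq₂]⟩
    choose rows' hrows' using hex
    set A := F i \ F (i.succAbove p)
    have hmul : ∀ j, xF K A * minor K (F ∘ i.succAbove) rows' j = xF K (V \ F (i.succAbove j)) ∨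
        xF K A * minor K (F ∘ i.succAbove) rows' j = -xF K (V \ F (i.succAbove j)) := by
      intro j
      obtain ⟨e, he⟩ := minor_succAbove K F rows rows' i k hrows' j
      have := eq_or_eq_neg_neg_one_pow_mul e (hdet (i.succAbove j))
      rwa [he, ← mul_assoc, ← pow_add, Even.neg_one_pow ⟨e, rfl⟩, one_mul, hp] at this
    have hA : ∀ j, A ⊆ V \ F (i.succAbove j) := by
      intro j
      apply subset_of_xF_dvd_xF K
      rcases hmul j with h | h
      · exact Dvd.intro _ h
      · exact (dvd_neg.1 (Dvd.intro _ h))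
    obtain ⟨L, hnd, hL, hR⟩ := ih (F ∘ i.succAbove)
      (hinj.comp Fin.succAbove_right_injective) (V \ A)
      (fun j v hv => mem_sdiff.2 ⟨hV _ hv, fun hvA => (mem_sdiff.1 (hA j hvA)).2 hv⟩)
      rows'
      (fun a h => hrows (k.succAbove a) (by rw [hrows']; simp [h]))
      (fun j => by
        have hsplit : xF K (V \ F (i.succAbove j)) =
            xF K A * xF K ((V \ A) \ F (i.succAbove j)) := by
          rw [xF_mul_of_disjoint]
          · congr 1
            ext v
            have := @hA j v
            simp only [mem_union, mem_sdiff] at this ⊢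
            tauto
          · exact disjoint_left.2 fun v hv h => by simp [hv] at h
        have := hmul j
        rw [hsplit, ← mul_neg] at this
        exact this.imp (mul_left_cancel₀ (xF_ne_zero K A)) (mul_left_cancel₀ (xF_ne_zero K A)))
    have hmem : ∀ H, H ∈ L ↔ H ∈ Set.range (F ∘ i.succAbove) := fun H => by rw [← hL]; rfl
    have hmem' := hmem
    simp only [range_comp_succAbove hinj] at hmem'
    refine ⟨F i :: L, List.nodup_cons.2 ⟨by simp [hmem'], hnd⟩, ?_, Or.inr ?_, hR⟩
    · ext H
      have : H = F i → H ∈ Set.range F := fun h => ⟨i, h.symm⟩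
      simp only [Set.mem_ofPred_eq, List.mem_cons, hmem', Set.mem_sdiff, Set.mem_singleton_iff]
      tauto
    · refine ⟨F (i.succAbove p), (hmem _).2 ⟨p, rfl⟩, fun H hH v hv => ?_⟩
      obtain ⟨j, rfl⟩ := (hmem H).1 hH
      by_contra hvp
      obtain ⟨h₁, h₂⟩ := mem_inter.1 hv
      exact (mem_sdiff.1 (hA j (mem_sdiff.2 ⟨h₂, hvp⟩))).2 h₁

lemma union_sdiff_self_of_inter_subset {α : Type*} [DecidableEq α] {V A G : Finset α}
    (hA : V ∩ A ⊆ G) (hG : G ⊆ V) : (V ∪ A) \ A = (G \ A) ∪ (V \ G) := by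
  grind

lemma union_sdiff_of_inter_subset {α : Type*} [DecidableEq α] {V A G H : Finset α}
    (hA : V ∩ A ⊆ G) (hG : G ⊆ V) (hH : H ⊆ V) : (V ∪ A) \ H = (A \ G) ∪ (V \ H) := by
  grind

/-- A leaf order of the family yields rows with signed monomial minors. -/
theorem exists_rows_of_runningIntersection {n t : ℕ} (K : Type) [Field K]
    (F : Fin (t + 1) → Finset (Fin n)) (hinj : Function.Injective F)
    (L : List (Finset (Fin n))) (hnd : L.Nodup) (hL : {A | A ∈ L} = Set.range F)
    (hR : RunningIntersection L) :
    ∃ rows : Fin t → Fin (t + 1) × Fin (t + 1), Function.Injective rows ∧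
      (∀ k, (rows k).1 < (rows k).2) ∧
      ∀ j, minor K F rows j = xF K (univ.biUnion F \ F j) ∨
        minor K F rows j = -xF K (univ.biUnion F \ F j) := by
  induction t generalizing L with
  | zero =>
    refine ⟨Fin.elim0, fun a => a.elim0, fun a => a.elim0, fun j => Or.inl ?_⟩
    have hj : univ.biUnion F \ F j = ∅ := by
      rw [sdiff_eq_empty_iff_subset, biUnion_subset]
      exact fun x _ => by rw [Fin.fin_one_eq_zero x, Fin.fin_one_eq_zero j]
    rw [hj]
    simp [minor, xF]
  | succ t ih =>
    have hmem : ∀ H, H ∈ L ↔ H ∈ Set.range F := fun H => by rw [← hL]; rfl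
    obtain _ | ⟨A, L⟩ := L
    · simpa using (hmem (F 0)).2 ⟨0, rfl⟩
    obtain ⟨i, rfl⟩ := (hmem A).1 (by simp)
    obtain ⟨hi, hnd'⟩ := List.nodup_cons.1 hnd
    have hL' : {A | A ∈ L} = Set.range (F ∘ i.succAbove) := by
      ext H
      rw [range_comp_succAbove hinj, Set.mem_sdiff, ← hmem]
      by_cases hH : H = F i <;> simp [hH, hi]
    have hmem' : ∀ H, H ∈ L ↔ H ∈ Set.range (F ∘ i.succAbove) := fun H => by rw [← hL']; rfl
    obtain ⟨rows', hinj', hlt, hdet⟩ := ih (F ∘ i.succAbove)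
      (hinj.comp Fin.succAbove_right_injective) L hnd' hL' hR.2
    set V := univ.biUnion (F ∘ i.succAbove) with hVdef
    obtain ⟨p, hp⟩ : ∃ p, ∀ j, F (i.succAbove j) ∩ F i ⊆ F (i.succAbove p) := by
      rcases hR.1 with h | ⟨G, hG, h⟩
      · simpa [h] using (hmem' (F (i.succAbove 0))).2 ⟨0, rfl⟩
      · obtain ⟨p, rfl⟩ := (hmem' G).1 hG
        exact ⟨p, fun j => h _ ((hmem' _).2 ⟨j, rfl⟩)⟩
    have hVi : V ∩ F i ⊆ F (i.succAbove p) := by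
      intro v hv
      obtain ⟨h₁, h₂⟩ := mem_inter.1 hv
      obtain ⟨j, -, hj⟩ := mem_biUnion.1 h₁
      exact hp j (mem_inter.2 ⟨hj, h₂⟩)
    have hFV : ∀ j, F (i.succAbove j) ⊆ V := fun j =>
      subset_biUnion_of_mem (F ∘ i.succAbove) (mem_univ j)
    have hU : univ.biUnion F = V ∪ F i := by
      ext v
      simp only [hVdef, mem_union, mem_biUnion, mem_univ, true_and, Function.comp]
      rw [Fin.exists_iff_succAbove i, or_comm]
    obtain ⟨r, hr, hri, hrp, hr0, hr_mem⟩ : ∃ r : Fin (t + 2) × Fin (t + 2), r.1 < r.2 ∧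
        rowEntry K F r i = xF K (F i \ F (i.succAbove p)) ∧
        rowEntry K F r (i.succAbove p) = xF K (F (i.succAbove p) \ F i) ∧
        (∀ c, c ≠ p → rowEntry K F r (i.succAbove c) = 0) ∧ (r.1 = i ∨ r.2 = i) := by
      have hne := Fin.succAbove_ne i p
      rcases hne.lt_or_gt with h | h
      · refine ⟨(i.succAbove p, i), h, ?_, ?_, fun c hc => ?_, Or.inr rfl⟩ <;>
          simp [rowEntry, hne.symm, *]
      · refine ⟨(i, i.succAbove p), h, ?_, ?_, fun c hc => ?_, Or.inl rfl⟩ <;>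
          simp [rowEntry, *]
    let rows : Fin (t + 1) → Fin (t + 2) × Fin (t + 2) :=
      Fin.cons r fun a => (rows' a).map i.succAbove i.succAbove
    have hrows : ∀ a, rows ((0 : Fin (t + 1)).succAbove a) =
        (rows' a).map i.succAbove i.succAbove := fun a => by simp [rows]
    refine ⟨rows, ?_, ?_, ?_⟩
    · refine Fin.cons_injective_iff.2 ⟨?_, ?_⟩
      · rintro ⟨a, rfl⟩
        rcases hr_mem with h | h <;> exact Fin.succAbove_ne _ _ h
      · exact (Fin.succAbove_right_injective.prodMap Fin.succAbove_right_injective).comp hinj'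
    · refine Fin.cases hr fun a => ?_
      exact Fin.strictMono_succAbove i (hlt a)
    · refine (Fin.forall_iff_succAbove i).2 ⟨?_, fun j => ?_⟩
      · obtain ⟨e, he⟩ := minor_self K F rows rows' i 0 hrows p hr0
        rw [he, show rows 0 = r from rfl]
        apply eq_or_eq_neg_neg_one_pow_mul
        rw [hrp, hU, union_sdiff_self_of_inter_subset hVi (hFV p), ← xF_mul_of_disjoint]
        · exact mul_eq_or_eq_neg _ (hdet p)
        · exact disjoint_sdiff.mono_left sdiff_subset
      · obtain ⟨e, he⟩ := minor_succAbove K F rows rows' i 0 hrows j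
        rw [he, show rows 0 = r from rfl]
        apply eq_or_eq_neg_neg_one_pow_mul
        rw [hri, hU, union_sdiff_of_inter_subset hVi (hFV p) (hFV j), ← xF_mul_of_disjoint]
        · exact mul_eq_or_eq_neg _ (hdet j)
        · refine disjoint_left.2 fun v hv hv' => (mem_sdiff.1 hv).2 (hVi ?_)
          exact mem_inter.2 ⟨(mem_sdiff.1 hv').1, (mem_sdiff.1 hv).1⟩

/-- Let `Δ` be a simplicial complex on `[n]` with facets `F₁, …, F_t`
(here `t + 1` facets, enumerated by `F : Fin (t+1) → _`).  Then `Δ` is a quasi-tree if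
and only if one can choose `t` rows of the matrix `M_Δ` (each row indexed by a pair
`i < j`) forming a submatrix `M^♯` such that for every `j`, deleting the `j`-th column
of `M^♯` yields a square matrix whose determinant is `± x_{[n]}/x_{F_j}`. -/
theorem stmt_6 {n t : ℕ} (K : Type) [Field K] (Δ : Set (Finset (Fin n)))
    (hΔ : IsComplex Δ) (F : Fin (t + 1) → Finset (Fin n))
    (hinj : Function.Injective F) (hF : Set.range F = facets Δ) :
    IsQuasiTree Δ ↔
      ∃ rows : Fin t → Fin (t + 1) × Fin (t + 1), Function.Injective rows ∧
        (∀ k, (rows k).1 < (rows k).2) ∧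
        ∀ j : Fin (t + 1),
          Matrix.det (Matrix.of fun k l : Fin t =>
              rowEntry K F (rows k) (j.succAbove l)) = xF K (F j)ᶜ ∨
          Matrix.det (Matrix.of fun k l : Fin t =>
              rowEntry K F (rows k) (j.succAbove l)) = - xF K (F j)ᶜ := by
  rw [isQuasiTree_iff_exists_runningIntersection, ← hF]
  constructor
  · rintro ⟨L, hnd, hL, hR⟩
    have hU : univ.biUnion F = univ := by
      refine eq_univ_of_forall fun v => ?_
      obtain ⟨A, hA, hmax⟩ := (Set.toFinite Δ).exists_le_maximal (hΔ.1 v)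
      obtain ⟨j, rfl⟩ : A ∈ Set.range F :=
        hF ▸ ⟨hmax.prop, fun G hG hAG => hmax.eq_of_le hG hAG⟩
      exact mem_biUnion.2 ⟨j, mem_univ j, hA (mem_singleton_self v)⟩
    have := exists_rows_of_runningIntersection K F hinj L hnd hL hR
    simp only [hU, ← compl_eq_univ_sdiff] at this
    exact this
  · rintro ⟨rows, -, hlt, hdet⟩
    refine exists_runningIntersection_of_minor K F hinj univ (fun j => subset_univ _) rows
      (fun k => (hlt k).ne) fun j => ?_
    rw [← compl_eq_univ_sdiff]
    exact hdet j
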